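/- Let F be a nonempty exposed face of B₁, let x̄ ∈ ri(F), and set s̄ = sign(D*x̄) and J̄ = cosupp(s̄). Then F = B₁ ∩ {x : ⟨Ds̄, x⟩ = 1} = ∂B₁ ∩ {x : sign(D*x) ≼ s̄} = {x : ⟨Ds̄, x⟩ = 1 and sign(D*x) ≼ s̄}; ri(F) = ∂B₁ ∩ {x : sign(D*x) = s̄} = {x : ⟨Ds̄, x⟩ = 1 and sign(D*x) = s̄}; and dir(F) = (Ds̄)⊥ ∩ Ker D*_J̄. -/

import Mathlib

open Matrix Set

noncomputable section

/-- `Vec n` is `ℝ^n`. -/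
abbrev Vec (n : ℕ) := Fin n → ℝ

/-- The ℓ¹-norm on `ℝ^p`. -/
def l1 {p : ℕ} (θ : Vec p) : ℝ := ∑ i, |θ i|

/-- The componentwise sign vector. -/
def sgn {p : ℕ} (θ : Vec p) : Vec p := fun i => Real.sign (θ i)

/-- `s` is a sign vector, i.e. `s ∈ {-1,0,1}^p`. -/
def IsSignVec {p : ℕ} (s : Vec p) : Prop := ∀ i, s i = -1 ∨ s i = 0 ∨ s i = 1

/-- The order `s ≼ s'` on sign vectors: `sᵢ ≠ 0 → s'ᵢ = sᵢ`. -/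
def sleq {p : ℕ} (s s' : Vec p) : Prop := ∀ i, s i ≠ 0 → s' i = s i

/-- The cosupport `{i : uᵢ = 0}`. -/
def cosupp {p : ℕ} (u : Vec p) : Set (Fin p) := {i | u i = 0}

/-- The analysis operator `D* x = Dᵀ x`. -/
def Dstar {n p : ℕ} (D : Matrix (Fin n) (Fin p) ℝ) (x : Vec n) : Vec p := Dᵀ *ᵥ x

/-- The ball `B_r = {x : ‖D*x‖₁ ≤ r}`. -/
def Ball {n p : ℕ} (D : Matrix (Fin n) (Fin p) ℝ) (r : ℝ) : Set (Vec n) :=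
  {x | l1 (Dstar D x) ≤ r}

/-- The sphere `∂B_r = {x : ‖D*x‖₁ = r}`. -/
def Sph {n p : ℕ} (D : Matrix (Fin n) (Fin p) ℝ) (r : ℝ) : Set (Vec n) :=
  {x | l1 (Dstar D x) = r}

/-- `Ker D*_J = {x : (D*x)ᵢ = 0 for all i ∈ J}`. -/
def kerDJ {n p : ℕ} (D : Matrix (Fin n) (Fin p) ℝ) (J : Set (Fin p)) : Set (Vec n) :=
  {x | ∀ i ∈ J, Dstar D x i = 0}

/-- The relative interior of a set. -/
def ri {n : ℕ} (C : Set (Vec n)) : Set (Vec n) := intrinsicInterior ℝ C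

/-- The direction of (the affine hull of) a set, as a set of vectors. -/
def dir {n : ℕ} (C : Set (Vec n)) : Set (Vec n) := ((affineSpan ℝ C).direction : Set (Vec n))

/-- `F` is an exposed face of `X`: the intersection of `X` with a supporting hyperplane. -/
def IsExposedFace {n : ℕ} (X F : Set (Vec n)) : Prop :=
  ∃ (α : Vec n) (β : ℝ), α ≠ 0 ∧ (∀ x ∈ X, α ⬝ᵥ x ≤ β) ∧ F = X ∩ {x | α ⬝ᵥ x = β}

/-- `G` is a face of `X`: a convex extreme subset of `X`. -/
def IsFace {n : ℕ} (X G : Set (Vec n)) : Prop := Convex ℝ G ∧ IsExtreme ℝ X G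

/-- `x` is an extreme point of `C`: it is not the midpoint of two distinct points of `C`. -/
def IsExtremePt {n : ℕ} (C : Set (Vec n)) (x : Vec n) : Prop :=
  x ∈ C ∧ ∀ x₁ ∈ C, ∀ x₂ ∈ C, x = midpoint ℝ x₁ x₂ → x₁ = x₂

/-- The objective `L(x) = (1/2)‖y − Φx‖₂² + λ‖D*x‖₁`. -/
def Lfun {n p q : ℕ} (D : Matrix (Fin n) (Fin p) ℝ) (Phi : Matrix (Fin q) (Fin n) ℝ)
    (y : Vec q) (lam : ℝ) (x : Vec n) : ℝ :=
  (1/2 : ℝ) * ((y - Phi *ᵥ x) ⬝ᵥ (y - Phi *ᵥ x)) + lam * l1 (Dstar D x)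

lemma aux_add {n p : ℕ} (D : Matrix (Fin n) (Fin p) ℝ) (x d : Vec n) (t : ℝ) (i : Fin p) :
    Dstar D (x + t • d) i = Dstar D x i + t * Dstar D d i := by
  simp [Dstar, Matrix.mulVec_add, Matrix.mulVec_smul]

lemma aux_smul {n p : ℕ} (D : Matrix (Fin n) (Fin p) ℝ) (x : Vec n) (t : ℝ) (i : Fin p) :
    Dstar D (t • x) i = t * Dstar D x i := by
  simp [Dstar, Matrix.mulVec_smul]

lemma aux_cont {n p : ℕ} (D : Matrix (Fin n) (Fin p) ℝ) (i : Fin p) :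
    Continuous (fun x : Vec n => Dstar D x i) := by
  unfold Dstar Matrix.mulVec dotProduct
  fun_prop

lemma aux_dot {n p : ℕ} (D : Matrix (Fin n) (Fin p) ℝ) (s : Vec p) (x : Vec n) :
    (D *ᵥ s) ⬝ᵥ x = ∑ i, s i * Dstar D x i := by
  rw [dotProduct_comm, Matrix.dotProduct_mulVec, dotProduct_comm, ← Matrix.mulVec_transpose]
  rfl

lemma sign_mul_le (a t : ℝ) : Real.sign a * t ≤ |t| := by
  rcases Real.sign_apply_eq a with h | h | h <;> rw [h]
  · have := neg_le_abs t; linarith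
  · simp
  · have := le_abs_self t; linarith

lemma sign_mul_iff (a t : ℝ) :
    Real.sign a * t = |t| ↔ (Real.sign t ≠ 0 → Real.sign a = Real.sign t) := by
  rcases lt_trichotomy t 0 with h | h | h
  · rw [Real.sign_of_neg h, abs_of_neg h]
    constructor
    · intro h1 _
      have : (Real.sign a + 1) * t = 0 := by linarith
      rcases mul_eq_zero.1 this with h2 | h2 <;> linarith
    · intro h1
      rw [h1 (by norm_num)]; ring
  · simp [h]
  · rw [Real.sign_of_pos h, abs_of_pos h]
    constructor
    · intro h1 _
      have : (Real.sign a - 1) * t = 0 := by linarith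
      rcases mul_eq_zero.1 this with h2 | h2 <;> linarith
    · intro h1
      rw [h1 (by norm_num)]; ring

lemma sign_eq_iff (a t : ℝ) :
    Real.sign t = Real.sign a ↔ (a = 0 → t = 0) ∧ (a ≠ 0 → 0 < Real.sign a * t) := by
  rcases lt_trichotomy a 0 with h | h | h
  · rw [Real.sign_of_neg h]
    rcases lt_trichotomy t 0 with h' | h' | h'
    · rw [Real.sign_of_neg h']; simp [h.ne, h']
    · simp [h', h.ne]
    · rw [Real.sign_of_pos h']; norm_num [h.ne]; exact h'.le
  · simp [h, Real.sign_eq_zero_iff]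
  · rw [Real.sign_of_pos h]
    rcases lt_trichotomy t 0 with h' | h' | h'
    · rw [Real.sign_of_neg h']; norm_num [h.ne']; exact h'.le
    · simp [h', h.ne']
    · rw [Real.sign_of_pos h']; simp [h.ne', h']

lemma dot_le {n p : ℕ} (D : Matrix (Fin n) (Fin p) ℝ) (y x : Vec n) :
    (D *ᵥ sgn (Dstar D y)) ⬝ᵥ x ≤ l1 (Dstar D x) := by
  rw [aux_dot]
  exact Finset.sum_le_sum fun i _ => sign_mul_le _ _

lemma dot_eq_iff {n p : ℕ} (D : Matrix (Fin n) (Fin p) ℝ) (y x : Vec n) :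
    (D *ᵥ sgn (Dstar D y)) ⬝ᵥ x = l1 (Dstar D x) ↔
      sleq (sgn (Dstar D x)) (sgn (Dstar D y)) := by
  have h : ∀ i ∈ Finset.univ, sgn (Dstar D y) i * Dstar D x i ≤ |Dstar D x i| :=
    fun i _ => sign_mul_le _ _
  rw [aux_dot, l1, Finset.sum_eq_sum_iff_of_le h]
  simp only [Finset.mem_univ, forall_const, sleq]
  exact forall_congr' fun i => sign_mul_iff _ _

lemma dot_self {n p : ℕ} (D : Matrix (Fin n) (Fin p) ℝ) (x : Vec n) :
    (D *ᵥ sgn (Dstar D x)) ⬝ᵥ x = l1 (Dstar D x) :=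
  (dot_eq_iff D x x).2 fun _ _ => rfl

/-- points of the face have norm one -/
lemma face_sph {n p : ℕ} (D : Matrix (Fin n) (Fin p) ℝ)
    (F : Set (Vec n)) (hF : IsExposedFace (Ball D 1) F) (x : Vec n) (hx : x ∈ F) :
    l1 (Dstar D x) = 1 := by
  obtain ⟨α, β, hα, hle, rfl⟩ := hF
  obtain ⟨hxB, hxβ⟩ := hx
  have hcont : Continuous (fun t : ℝ => l1 (Dstar D (t • α))) := by
    simp only [l1, aux_smul]; fun_prop
  have h0 : l1 (Dstar D ((0:ℝ) • α)) < 1 := by simp [l1, Dstar]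
  have hev := (hcont.tendsto 0).eventually (gt_mem_nhds h0)
  obtain ⟨t, ht, htpos⟩ := ((hev.filter_mono nhdsWithin_le_nhds).and
    (self_mem_nhdsWithin : Ioi (0:ℝ) ∈ nhdsWithin 0 (Ioi 0))).exists
  have h1 := hle (t • α) ht.le
  rw [dotProduct_smul, smul_eq_mul] at h1
  have h2 : 0 < α ⬝ᵥ α := by
    have h3 : 0 ≤ α ⬝ᵥ α := Finset.sum_nonneg fun i _ => mul_self_nonneg _
    exact lt_of_le_of_ne h3 fun h => hα (dotProduct_self_eq_zero.1 h.symm)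
  have hβ : 0 < β := lt_of_lt_of_le (mul_pos htpos h2) h1
  by_contra hne
  set r := l1 (Dstar D x) with hr
  have hr1 : r < 1 := lt_of_le_of_ne hxB hne
  have hr0 : 0 ≤ r := Finset.sum_nonneg fun i _ => abs_nonneg _
  have hc : 1 < 2 / (1 + r) := by rw [lt_div_iff₀ (by linarith)]; linarith
  have h4 : l1 (Dstar D ((2 / (1 + r)) • x)) = (2 / (1 + r)) * r := by
    rw [hr]
    conv_lhs => rw [l1]
    simp only [aux_smul, abs_mul, ← Finset.mul_sum]
    rw [abs_of_pos (by rw [← hr]; linarith)]; rfl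
  have h5 := hle ((2 / (1 + r)) • x) (by
    change l1 _ ≤ 1
    rw [h4, div_mul_eq_mul_div, div_le_one (by linarith)]; linarith)
  have hxβ' : α ⬝ᵥ x = β := hxβ
  rw [dotProduct_smul, smul_eq_mul, hxβ'] at h5
  nlinarith

lemma ri_extend {n : ℕ} (F : Set (Vec n)) (y x : Vec n) (hy : y ∈ ri F) (hx : x ∈ F) :
    ∃ ε : ℝ, 0 < ε ∧ y + ε • (y - x) ∈ F := by
  obtain ⟨y, hyi, rfl⟩ := mem_intrinsicInterior.1 hy
  have hxs := subset_affineSpan ℝ F hx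
  have hmem : ∀ ε : ℝ, (y : Vec n) + ε • ((y : Vec n) - x) ∈ affineSpan ℝ F := by
    intro ε
    have := AffineMap.lineMap_mem (-ε) y.2 hxs
    convert this using 1
    simp [AffineMap.lineMap_apply]
    ext i; simp; ring
  let f : ℝ → affineSpan ℝ F := fun ε => ⟨_, hmem ε⟩
  have hf : Continuous f := by
    apply Continuous.subtype_mk
    fun_prop
  have hf0 : f 0 = y := by ext1; simp [f]
  have h1 : ∀ᶠ ε in nhds (0:ℝ), f ε ∈ ((↑) ⁻¹' F : Set (affineSpan ℝ F)) := by
    apply hf.continuousAt.eventually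
    rw [hf0]
    exact mem_interior_iff_mem_nhds.1 hyi
  obtain ⟨t, ht, htpos⟩ := ((h1.filter_mono nhdsWithin_le_nhds).and
    (self_mem_nhdsWithin : Ioi (0:ℝ) ∈ nhdsWithin 0 (Ioi 0))).exists
  exact ⟨t, htpos, ht⟩

lemma ri_dot {n p : ℕ} (D : Matrix (Fin n) (Fin p) ℝ)
    (F : Set (Vec n)) (hF : IsExposedFace (Ball D 1) F) (y x : Vec n)
    (hy : y ∈ ri F) (hx : x ∈ F) :
    (D *ᵥ sgn (Dstar D y)) ⬝ᵥ x = 1 := by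
  obtain ⟨ε, hε, hz⟩ := ri_extend F y x hy hx
  have h1 := dot_le D y (y + ε • (y - x))
  have h2 := dot_le D y x
  rw [face_sph D F hF _ hz] at h1
  rw [face_sph D F hF _ hx] at h2
  rw [dotProduct_add, dotProduct_smul, dotProduct_sub, dot_self,
    face_sph D F hF _ (intrinsicInterior_subset hy), smul_eq_mul] at h1
  nlinarith

lemma perturb {n p : ℕ} (D : Matrix (Fin n) (Fin p) ℝ) (y d : Vec n)
    (hd : d ∈ kerDJ D (cosupp (sgn (Dstar D y)))) :
    ∀ᶠ ε in nhds (0:ℝ), sgn (Dstar D (y + ε • d)) = sgn (Dstar D y) := by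
  have : ∀ i, ∀ᶠ ε in nhds (0:ℝ),
      Real.sign (Dstar D (y + ε • d) i) = Real.sign (Dstar D y i) := by
    intro i
    simp only [aux_add]
    by_cases h : Dstar D y i = 0
    · have : Dstar D d i = 0 := hd i (by simp [cosupp, sgn, h])
      simp [this]
    · have h1 := ((sign_eq_iff (Dstar D y i) (Dstar D y i)).1 rfl).2 h
      have hc : Continuous fun ε : ℝ => 
        Real.sign (Dstar D y i) * (Dstar D y i + ε * Dstar D d i) := by fun_prop
      have := (hc.tendsto 0).eventually (lt_mem_nhds (by simpa using h1))
      filter_upwards [this] with ε hε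
      exact (sign_eq_iff _ _).2 ⟨fun h' => absurd h' h, fun _ => hε⟩
  filter_upwards [Filter.eventually_all.2 this] with ε hε
  exact funext hε

lemma face_eq {n p : ℕ} (D : Matrix (Fin n) (Fin p) ℝ)
    (F : Set (Vec n)) (hF : IsExposedFace (Ball D 1) F) (xb : Vec n) (hxb : xb ∈ ri F) :
    F = {x | (D *ᵥ sgn (Dstar D xb)) ⬝ᵥ x = 1 ∧
      sleq (sgn (Dstar D x)) (sgn (Dstar D xb))} := by
  have hxF : xb ∈ F := intrinsicInterior_subset hxb
  have hx1 := face_sph D F hF xb hxF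
  ext x
  constructor
  · intro hx
    have h1 := ri_dot D F hF xb x hxb hx
    exact ⟨h1, (dot_eq_iff D xb x).1 (by rw [h1, face_sph D F hF x hx])⟩
  · rintro ⟨h1, h2⟩
    have hl : l1 (Dstar D x) = 1 := by rw [← (dot_eq_iff D xb x).2 h2, h1]
    have hd : xb - x ∈ kerDJ D (cosupp (sgn (Dstar D xb))) := by
      intro i hi
      have hi' : Real.sign (Dstar D xb i) = 0 := hi
      have e : xb - x = xb + (-1:ℝ) • x := by simp [sub_eq_add_neg]
      rw [e, aux_add, Real.sign_eq_zero_iff.1 hi']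
      have : Real.sign (Dstar D x i) = 0 := by
        by_contra h
        exact h ((h2 i h).symm.trans hi')
      rw [Real.sign_eq_zero_iff.1 this]; simp
    obtain ⟨t, ht, htpos⟩ := (((perturb D xb _ hd).filter_mono nhdsWithin_le_nhds).and
      (self_mem_nhdsWithin : Ioi (0:ℝ) ∈ nhdsWithin 0 (Ioi 0))).exists
    have htpos : 0 < t := htpos
    have hz : l1 (Dstar D (xb + t • (xb - x))) = 1 := by
      rw [← dot_self, ht, dotProduct_add, dotProduct_smul, dotProduct_sub, dot_self, hx1, h1]
      simp
    obtain ⟨α, β, hα, hle, rfl⟩ := hF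
    refine ⟨hl.le, ?_⟩
    have h3 := hle _ (show _ ∈ Ball D 1 from hz.le)
    have h4 := hle _ (show _ ∈ Ball D 1 from hl.le)
    have h5 : α ⬝ᵥ xb = β := hxF.2
    rw [dotProduct_add, dotProduct_smul, dotProduct_sub, h5, smul_eq_mul] at h3
    change α ⬝ᵥ x = β
    nlinarith

lemma span_le {n p : ℕ} (D : Matrix (Fin n) (Fin p) ℝ)
    (F : Set (Vec n)) (s : Vec p)
    (hF : F = {x | (D *ᵥ s) ⬝ᵥ x = 1 ∧ sleq (sgn (Dstar D x)) s}) (x : Vec n)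
    (hx : x ∈ affineSpan ℝ F) : (D *ᵥ s) ⬝ᵥ x = 1 ∧ x ∈ kerDJ D (cosupp s) := by
  refine affineSpan_induction (p := fun x => (D *ᵥ s) ⬝ᵥ x = 1 ∧ x ∈ kerDJ D (cosupp s))
    hx (fun x hx => ?_) (fun c u v w hu hv hw => ?_)
  · rw [hF] at hx
    refine ⟨hx.1, fun i hi => ?_⟩
    have : Real.sign (Dstar D x i) = 0 := by
      by_contra h
      exact h ((hx.2 i h).symm.trans hi)
    exact Real.sign_eq_zero_iff.1 this
  · have e : c • (u -ᵥ v) +ᵥ w = (w + c • u) + (-c) • v := by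
      ext i; simp; ring
    rw [e]
    refine ⟨?_, fun i hi => ?_⟩
    · simp only [dotProduct_add, dotProduct_smul, hu.1, hv.1, hw.1]; simp
    · rw [aux_add, aux_add, hu.2 i hi, hv.2 i hi, hw.2 i hi]; simp

lemma ri_eq {n p : ℕ} (D : Matrix (Fin n) (Fin p) ℝ)
    (F : Set (Vec n)) (hF : IsExposedFace (Ball D 1) F) (xb : Vec n) (hxb : xb ∈ ri F) :
    ri F = {x | (D *ᵥ sgn (Dstar D xb)) ⬝ᵥ x = 1 ∧
      sgn (Dstar D x) = sgn (Dstar D xb)} := by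
  have hFe := face_eq D F hF xb hxb
  ext x
  constructor
  · intro hx
    have hxF : x ∈ F := intrinsicInterior_subset hx
    have h1 : x ∈ {x | (D *ᵥ sgn (Dstar D xb)) ⬝ᵥ x = 1 ∧
      sleq (sgn (Dstar D x)) (sgn (Dstar D xb))} := hFe ▸ hxF
    have h2 : xb ∈ {z | (D *ᵥ sgn (Dstar D x)) ⬝ᵥ z = 1 ∧
      sleq (sgn (Dstar D z)) (sgn (Dstar D x))} := by
      rw [← face_eq D F hF x hx]; exact intrinsicInterior_subset hxb
    refine ⟨h1.1, funext fun i => ?_⟩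
    by_cases h : sgn (Dstar D x) i = 0
    · by_contra h'
      exact h' (h2.2 i (fun h'' => h' (h.trans h''.symm)))
    · exact (h1.2 i h).symm
  · rintro ⟨h1, h2⟩
    have hxF : x ∈ F := by
      rw [hFe]; exact ⟨h1, fun i _ => by rw [h2]⟩
    refine mem_intrinsicInterior.2 ⟨⟨x, subset_affineSpan ℝ F hxF⟩, ?_, rfl⟩
    rw [mem_interior_iff_mem_nhds]
    have : ∀ i, ∀ᶠ y : affineSpan ℝ F in nhds ⟨x, subset_affineSpan ℝ F hxF⟩,
        Real.sign (Dstar D (y : Vec n) i) = Real.sign (Dstar D xb i) := by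
      intro i
      by_cases h : Dstar D xb i = 0
      · refine Filter.Eventually.of_forall fun y => ?_
        rw [h, (span_le D F _ hFe y y.2).2 i (by simp [cosupp, sgn, h])]
      · have h3 := ((sign_eq_iff (Dstar D xb i) (Dstar D x i)).1 (congrFun h2 i)).2 h
        have hc : Continuous fun y : affineSpan ℝ F =>
            Real.sign (Dstar D xb i) * Dstar D (y : Vec n) i :=
          continuous_const.mul ((aux_cont D i).comp continuous_subtype_val)
        have := (hc.tendsto ⟨x, subset_affineSpan ℝ F hxF⟩).eventually (lt_mem_nhds h3)
        filter_upwards [this] with y hy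
        exact (sign_eq_iff _ _).2 ⟨fun h' => absurd h' h, fun _ => hy⟩
    filter_upwards [Filter.eventually_all.2 this] with y hy
    have h4 : (y : Vec n) ∈ {x | (D *ᵥ sgn (Dstar D xb)) ⬝ᵥ x = 1 ∧
      sleq (sgn (Dstar D x)) (sgn (Dstar D xb))} :=
      ⟨(span_le D F _ hFe y y.2).1, fun i _ => (hy i).symm⟩
    rw [← hFe] at h4
    exact h4

lemma dir_eq {n p : ℕ} (D : Matrix (Fin n) (Fin p) ℝ)
    (F : Set (Vec n)) (hF : IsExposedFace (Ball D 1) F) (xb : Vec n) (hxb : xb ∈ ri F) :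
    dir F = {d : Vec n | (D *ᵥ sgn (Dstar D xb)) ⬝ᵥ d = 0} ∩
      kerDJ D (cosupp (sgn (Dstar D xb))) := by
  have hFe := face_eq D F hF xb hxb
  have hxF : xb ∈ F := intrinsicInterior_subset hxb
  have hxS := subset_affineSpan ℝ F hxF
  have hx1 := span_le D F _ hFe xb hxS
  ext d
  constructor
  · intro hd
    have h1 := span_le D F _ hFe _ (AffineSubspace.vadd_mem_of_mem_direction hd hxS)
    have e : d +ᵥ xb = xb + (1:ℝ) • d := by simp [add_comm]
    rw [e] at h1
    refine ⟨?_, fun i hi => ?_⟩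
    · have := h1.1
      rw [dotProduct_add, hx1.1] at this
      simpa using this
    · have := h1.2 i hi
      rw [aux_add, hx1.2 i hi] at this
      simpa using this
  · rintro ⟨h1, h2⟩
    have h1 : (D *ᵥ sgn (Dstar D xb)) ⬝ᵥ d = 0 := h1
    obtain ⟨t, ht, htpos⟩ := (((perturb D xb _ h2).filter_mono nhdsWithin_le_nhds).and
      (self_mem_nhdsWithin : Ioi (0:ℝ) ∈ nhdsWithin 0 (Ioi 0))).exists
    have htpos : 0 < t := htpos
    have hz : xb + t • d ∈ F := by
      rw [hFe]
      refine ⟨?_, fun i _ => by rw [ht]⟩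
      rw [dotProduct_add, hx1.1, dotProduct_smul, h1]; simp
    have h3 := AffineSubspace.vsub_mem_direction (subset_affineSpan ℝ F hz) hxS
    have h4 := Submodule.smul_mem _ t⁻¹ h3
    have e : t⁻¹ • (xb + t • d -ᵥ xb) = d := by
      simp [smul_smul, htpos.ne']
    rw [e] at h4
    exact h4

/-- description of a nonempty exposed face `F` of `B₁` through the sign
`s̄ = sign(D*x̄)` of any `x̄ ∈ ri(F)`, with `J̄ = cosupp(s̄)`. -/
theorem stmt_12 {n p : ℕ} (hn : 0 < n) (hp : 0 < p) (D : Matrix (Fin n) (Fin p) ℝ)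
    (F : Set (Vec n)) (hF : IsExposedFace (Ball D 1) F) (hFne : F.Nonempty)
    (xb : Vec n) (hxb : xb ∈ ri F)
    (sb : Vec p) (hsb : sb = sgn (Dstar D xb))
    (Jb : Set (Fin p)) (hJb : Jb = cosupp sb) :
    F = Ball D 1 ∩ {x | (D *ᵥ sb) ⬝ᵥ x = 1} ∧
    F = Sph D 1 ∩ {x | sleq (sgn (Dstar D x)) sb} ∧
    F = {x | (D *ᵥ sb) ⬝ᵥ x = 1 ∧ sleq (sgn (Dstar D x)) sb} ∧
    ri F = Sph D 1 ∩ {x | sgn (Dstar D x) = sb} ∧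
    ri F = {x | (D *ᵥ sb) ⬝ᵥ x = 1 ∧ sgn (Dstar D x) = sb} ∧
    dir F = {d : Vec n | (D *ᵥ sb) ⬝ᵥ d = 0} ∩ kerDJ D Jb := by
  subst hsb
  subst hJb
  have hFe := face_eq D F hF xb hxb
  have hRe := ri_eq D F hF xb hxb
  refine ⟨?_, ?_, hFe, ?_, hRe, dir_eq D F hF xb hxb⟩
  · rw [hFe]
    ext x
    constructor
    · rintro ⟨h1, h2⟩
      refine ⟨?_, h1⟩
      change l1 _ ≤ 1
      rw [← (dot_eq_iff D xb x).2 h2, h1]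
    · rintro ⟨h1, h2⟩
      have h1 : l1 (Dstar D x) ≤ 1 := h1
      have h2 : (D *ᵥ sgn (Dstar D xb)) ⬝ᵥ x = 1 := h2
      exact ⟨h2, (dot_eq_iff D xb x).1 (le_antisymm (dot_le D xb x) (by rw [h2]; exact h1))⟩
  · rw [hFe]
    ext x
    constructor
    · rintro ⟨h1, h2⟩
      exact ⟨((dot_eq_iff D xb x).2 h2).symm.trans h1, h2⟩
    · rintro ⟨h1, h2⟩
      exact ⟨((dot_eq_iff D xb x).2 h2).trans h1, h2⟩
  · rw [hRe]
    ext x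
    constructor
    · rintro ⟨h1, h2⟩
      refine ⟨?_, h2⟩
      change l1 _ = 1
      rw [← dot_self, h2, h1]
    · rintro ⟨h1, h2⟩
      refine ⟨?_, h2⟩
      have h2 : sgn (Dstar D x) = sgn (Dstar D xb) := h2
      rw [← h2, dot_self]; exact h1
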